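/- arXiv:0711.3832 — 2 statements merged into one kernel-verified Lean document; each statement's English description precedes it below -/
import Mathlib

section
/- Let α, β ∈ [0,r] ∩ A with α < β and set I = (α,β). Let x ∈ F_I be such that fix(x) ∩ I ∩ A = ∅. Then the centralizer C of x in F_I is a cyclic group, i.e. there exists c ∈ C with C = ⟨c⟩. -/
open Set

/-- `L` (the `Λ` of the paper) is a subgroup of the multiplicative group of positive reals. -/
def IsSlopeSubgroup (L : Set ℝ) : Prop :=
  (∀ p ∈ L, (0:ℝ) < p) ∧ (1:ℝ) ∈ L ∧ (∀ p ∈ L, ∀ q ∈ L, p * q ∈ L) ∧ ∀ p ∈ L, p⁻¹ ∈ L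

/-- `A` is an additive subgroup of `ℝ`, containing `r`, stable under multiplication
by the elements of `L`. -/
def IsSlopeModule (r : ℝ) (L A : Set ℝ) : Prop :=
  r ∈ A ∧ (0:ℝ) ∈ A ∧ (∀ a ∈ A, ∀ b ∈ A, a + b ∈ A) ∧ (∀ a ∈ A, -a ∈ A) ∧
    ∀ p ∈ L, ∀ a ∈ A, p * a ∈ A

/-- The support of a permutation of `ℝ`. -/
def psupp (f : Equiv.Perm ℝ) : Set ℝ := {x | f x ≠ x}

/-- `f` is affine with slope `k` on the set `s`. -/
def AffOn (f : ℝ → ℝ) (s : Set ℝ) (k : ℝ) : Prop := ∃ m, ∀ x ∈ s, f x = k * x + m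

/-- `f` is piecewise affine with finitely many breakpoints, all breakpoints
(necessarily lying in `[0,r]`) and their images lying in `A`, and all slopes in `L`. -/
def PiecewiseAffine (r : ℝ) (L A : Set ℝ) (f : Equiv.Perm ℝ) : Prop :=
  ∃ B : Finset ℝ, (B : Set ℝ) ⊆ A ∩ Icc 0 r ∧ (∀ x ∈ B, f x ∈ A) ∧
    ∀ x : ℝ, x ∉ (B : Set ℝ) → ∃ ε > 0, ∃ k ∈ L, AffOn (⇑f) (Ioo (x - ε) (x + ε)) k

/-- Membership in the group `F(r,L,A)`.  We model bijections of `[0,r)` onto itself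
as permutations of `ℝ` fixing the complement of `[0,r)` pointwise.  An element of
`F(r,L,A)` is such a permutation which is continuous (equivalently, its restriction
to `[0,r)` is a homeomorphism of `[0,r)` for the usual topology) and piecewise
affine with all slopes in `L` and all breakpoints, together with their images, in `A`. -/
def memF (r : ℝ) (L A : Set ℝ) (f : Equiv.Perm ℝ) : Prop :=
  (∀ x : ℝ, x ∉ Ico (0:ℝ) r → f x = x) ∧ Continuous ⇑f ∧ PiecewiseAffine r L A f

/-- Membership in `F_S(r,L,A) = {x ∈ F(r,L,A) : supp x ⊆ S}`. -/
def memFS (r : ℝ) (L A : Set ℝ) (S : Set ℝ) (f : Equiv.Perm ℝ) : Prop :=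
  memF r L A f ∧ psupp f ⊆ S

/-- `f` has right slope `k` at `a`: `f` is affine with slope `k` on an interval
immediately to the right of `a`. -/
def HasRightSlope (f : ℝ → ℝ) (a k : ℝ) : Prop := ∃ b > a, AffOn f (Ioo a b) k

/-- `f` has left slope `k` at `b`: `f` is affine with slope `k` on an interval
immediately to the left of `b`. -/
def HasLeftSlope (f : ℝ → ℝ) (b k : ℝ) : Prop := ∃ a < b, AffOn f (Ioo a b) k

open Filter Topology

/-- `f` is affine with slope `k` on a segment issuing from `p` in the direction of `e`. -/
def HasSlopeToward (e : ℝ) (f : ℝ → ℝ) (p k : ℝ) : Prop :=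
  ∃ δ > 0, ∀ w ∈ Icc 0 δ, f (p + e * w) = f p + e * (k * w)

theorem locallyAffine_iff {f : ℝ → ℝ} {L : Set ℝ} {p : ℝ} :
    (∃ ε > 0, ∃ k ∈ L, AffOn f (Ioo (p - ε) (p + ε)) k) ↔
      ∃ k ∈ L, ∃ m, ∀ᶠ q in 𝓝 p, f q = k * q + m := by
  simp only [(nhds_basis_Ioo_pos p).eventually_iff, AffOn]
  constructor
  · rintro ⟨ε, hε, k, hk, m, h⟩
    exact ⟨k, hk, m, ε, hε, fun q hq => h q hq⟩
  · rintro ⟨k, hk, m, ε, hε, h⟩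
    exact ⟨ε, hε, k, hk, m, fun q hq => h hq⟩

theorem affine_eq_of_eventually_eq {k m k' m' p : ℝ}
    (h : ∀ᶠ q in 𝓝 p, k * q + m = k' * q + m') : k = k' ∧ m = m' := by
  obtain ⟨ε, hε, h⟩ := (nhds_basis_Ioo_pos p).eventually_iff.1 h
  have h1 := h (x := p) ⟨by linarith, by linarith⟩
  have h2 := h (x := p + ε / 2) ⟨by linarith, by linarith⟩
  have h3 : (k - k') * (ε / 2) = 0 := by linarith
  have h4 : k = k' := by
    rcases mul_eq_zero.1 h3 with h | h <;> linarith
  subst h4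
  exact ⟨rfl, by linarith⟩

theorem exists_affine_of_locallyAffine {f : ℝ → ℝ} {L s : Set ℝ} (hs : IsPreconnected s)
    (hne : s.Nonempty)
    (h : ∀ p ∈ s, ∃ k ∈ L, ∃ m, ∀ᶠ q in 𝓝 p, f q = k * q + m) :
    ∃ k ∈ L, ∃ m, ∀ p ∈ s, f p = k * p + m := by
  obtain ⟨p₀, hp₀⟩ := hne
  obtain ⟨k, hk, m, hkm⟩ := h p₀ hp₀
  refine ⟨k, hk, m, fun p hp => ?_⟩
  have hsub : s ⊆ {p | ∀ᶠ q in 𝓝 p, f q = k * q + m} := by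
    refine hs.subset_of_closure_inter_subset isOpen_setOfPred_eventually_nhds ⟨p₀, hp₀, hkm⟩ ?_
    rintro p ⟨hpc, hps⟩
    obtain ⟨k', -, m', hp'⟩ := h p hps
    obtain ⟨p₁, h₁, h₂⟩ := mem_closure_iff_nhds.1 hpc _ (eventually_eventually_nhds.2 hp')
    obtain ⟨rfl, rfl⟩ : k' = k ∧ m' = m := by
      apply affine_eq_of_eventually_eq (p := p₁)
      filter_upwards [h₁, h₂] with q hq hq'
      rw [← hq, ← hq']
    exact hp'
  exact (hsub hp).self_of_nhds

theorem perm_apply_inv (f : Equiv.Perm ℝ) (p : ℝ) : f (f⁻¹ p) = p := f.apply_symm_apply p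

theorem perm_inv_apply (f : Equiv.Perm ℝ) (p : ℝ) : f⁻¹ (f p) = p := f.symm_apply_apply p

namespace memF

variable {r : ℝ} {L A : Set ℝ} {f g : Equiv.Perm ℝ}

theorem strictMono (hf : memF r L A f) : StrictMono f := by
  rcases hf.2.1.strictMono_of_inj f.injective with h | h
  · exact h
  · have h1 := hf.1 (-1) (fun h => by linarith [h.1])
    have h2 := hf.1 (-2) (fun h => by linarith [h.1])
    have := h (show (-2 : ℝ) < -1 by norm_num)
    linarith

theorem continuous_inv (hf : memF r L A f) : Continuous (f⁻¹ : Equiv.Perm ℝ) :=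
  (hf.strictMono.orderIsoOfSurjective f f.surjective).symm.continuous.congr fun p =>
    f.injective <| by
      rw [perm_apply_inv]
      exact (hf.strictMono.orderIsoOfSurjective f f.surjective).apply_symm_apply p

theorem inv_apply_eq_self (hf : memF r L A f) {p : ℝ} (hp : p ∉ Ico 0 r) : f⁻¹ p = p := by
  rw [Equiv.Perm.inv_eq_iff_eq, hf.1 p hp]

theorem map_Icc (hf : memF r L A f) {p : ℝ} (hp : p ∈ Icc 0 r) : f p ∈ Icc 0 r := by
  constructor
  · by_contra! h
    have := f.injective (hf.1 (f p) fun h' => by linarith [h'.1])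
    linarith [hp.1]
  · have := hf.strictMono.monotone hp.2
    rwa [hf.1 r (by simp)] at this

theorem inv_map_Icc (hf : memF r L A f) {p : ℝ} (hp : p ∈ Icc 0 r) : f⁻¹ p ∈ Icc 0 r := by
  have hfp : f (f⁻¹ p) = p := perm_apply_inv f p
  constructor
  · by_contra! h
    have := hf.1 (f⁻¹ p) fun h' => by linarith [h'.1]
    linarith [hp.1]
  · by_contra! h
    have := hf.1 (f⁻¹ p) fun h' => by linarith [h'.2]
    linarith [hp.2]

theorem exists_hasSlopeToward (hf : memF r L A f) (p : ℝ) :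
    (∃ k ∈ L, HasSlopeToward 1 f p k) ∧ ∃ k ∈ L, HasSlopeToward (-1) f p k := by
  obtain ⟨B, -, -, hB⟩ := hf.2.2
  have hcl : ((B : Set ℝ) \ {p})ᶜ ∈ 𝓝 p :=
    (B.finite_toSet.subset sdiff_subset).isClosed.isOpen_compl.mem_nhds (by simp)
  obtain ⟨ε, hε, hεB⟩ := (nhds_basis_Ioo_pos p).mem_iff.1 hcl
  have hloc : ∀ q ∈ Ioo (p - ε) (p + ε), q ≠ p →
      ∃ k ∈ L, ∃ m, ∀ᶠ q' in 𝓝 q, f q' = k * q' + m := fun q hq hqp =>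
    locallyAffine_iff.1 (hB q fun hqB => hεB hq ⟨hqB, hqp⟩)
  have hclosed : ∀ k m, IsClosed {q | f q = k * q + m} := fun k m =>
    isClosed_eq hf.2.1 (by fun_prop)
  constructor
  · obtain ⟨k, hk, m, h⟩ := exists_affine_of_locallyAffine (f := f) (L := L)
      (isPreconnected_Ioo (a := p) (b := p + ε)) (nonempty_Ioo.2 (by linarith))
      fun q hq => hloc q ⟨by linarith [hq.1], hq.2⟩ hq.1.ne'
    have h' : Icc p (p + ε) ⊆ {q | f q = k * q + m} := by
      rw [← closure_Ioo (by linarith)]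
      exact closure_minimal h (hclosed k m)
    refine ⟨k, hk, ε, hε, fun w hw => ?_⟩
    rw [h' (show p + 1 * w ∈ _ from ⟨by linarith [hw.1], by linarith [hw.2]⟩),
      h' (show p ∈ _ from ⟨le_rfl, by linarith⟩)]
    ring
  · obtain ⟨k, hk, m, h⟩ := exists_affine_of_locallyAffine (f := f) (L := L)
      (isPreconnected_Ioo (a := p - ε) (b := p)) (nonempty_Ioo.2 (by linarith))
      fun q hq => hloc q ⟨hq.1, by linarith [hq.2]⟩ hq.2.ne
    have h' : Icc (p - ε) p ⊆ {q | f q = k * q + m} := by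
      rw [← closure_Ioo (by linarith)]
      exact closure_minimal h (hclosed k m)
    refine ⟨k, hk, ε, hε, fun w hw => ?_⟩
    rw [h' (show p + -1 * w ∈ _ from ⟨by linarith [hw.2], by linarith [hw.1]⟩),
      h' (show p ∈ _ from ⟨by linarith, le_rfl⟩)]
    ring

theorem map_zero (hf : memF r L A f) (hr : 0 ≤ r) : f 0 = 0 := by
  have h0 : (0 : ℝ) ∈ Icc 0 r := ⟨le_rfl, hr⟩
  have h := hf.strictMono.monotone (hf.inv_map_Icc h0).1
  rw [perm_apply_inv f] at h
  exact le_antisymm h (hf.map_Icc h0).1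

theorem map_mem_iff (hL : IsSlopeSubgroup L) (hA : IsSlopeModule r L A)
    (hf : memF r L A f) (p : ℝ) : f p ∈ A ↔ p ∈ A := by
  obtain ⟨-, h0, hadd, hneg, hmul⟩ := hA
  obtain ⟨B, hBA, hfB, hB⟩ := hf.2.2
  by_cases hp : p ∈ Ico 0 r
  swap
  · rw [hf.1 p hp]
  have hf0 : f 0 = 0 := hf.map_zero (hp.1.trans hp.2.le)
  by_cases hpB : p ∈ B
  · exact iff_of_true (hfB p hpB) (hBA hpB).1
  rcases hp.1.eq_or_lt with rfl | hp0
  · rw [hf0]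
  have hne : (insert 0 B |>.filter (· < p)).Nonempty := ⟨0, by simp [hp0]⟩
  obtain ⟨b, hb, hbmax⟩ := Finset.exists_max_image _ id hne
  rw [Finset.mem_filter, Finset.mem_insert] at hb
  obtain ⟨hbB, hbp⟩ := hb
  obtain ⟨k, hk, m, hkm⟩ := exists_affine_of_locallyAffine (f := f) (L := L)
    (isPreconnected_Ioc (a := b) (b := p)) (nonempty_Ioc.2 hbp) fun q hq => by
      refine locallyAffine_iff.1 (hB q fun hqB => ?_)
      rcases hq.2.lt_or_eq with h | h
      · exact absurd (hbmax q (Finset.mem_filter.2 ⟨Finset.mem_insert_of_mem hqB, h⟩))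
          (not_le.2 hq.1)
      · exact hpB (h ▸ hqB)
  have hclosed : Icc b p ⊆ {q | f q = k * q + m} := by
    rw [← closure_Ioc hbp.ne]
    exact closure_minimal hkm (isClosed_eq hf.2.1 (by fun_prop))
  have hfb := hclosed (left_mem_Icc.2 hbp.le)
  have hfp := hclosed (right_mem_Icc.2 hbp.le)
  simp only [mem_ofPred_eq] at hfb hfp
  have hk0 := hL.1 k hk
  have hbA : b ∈ A ∧ f b ∈ A := by
    rcases hbB with rfl | h
    · exact ⟨h0, hf0.symm ▸ h0⟩
    · exact ⟨(hBA h).1, hfB b h⟩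
  constructor
  · intro h
    have : p = k⁻¹ * (f p + -f b) + b := by
      rw [hfp, hfb]
      field_simp
      ring
    rw [this]
    exact hadd _ (hmul _ (hL.2.2.2 k hk) _ (hadd _ h _ (hneg _ hbA.2))) _ hbA.1
  · intro h
    have : f p = k * (p + -b) + f b := by
      rw [hfp, hfb]
      ring
    rw [this]
    exact hadd _ (hmul _ hk _ (hadd _ h _ (hneg _ hbA.1))) _ hbA.2

theorem one (hL : IsSlopeSubgroup L) : memF r L A 1 :=
  ⟨fun _ _ => rfl, continuous_id, ∅, by simp, by simp, fun _ _ =>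
    ⟨1, one_pos, 1, hL.2.1, 0, by simp⟩⟩

theorem mul (hL : IsSlopeSubgroup L) (hA : IsSlopeModule r L A) (hf : memF r L A f)
    (hg : memF r L A g) : memF r L A (f * g) := by
  refine ⟨fun p hp => ?_, hf.2.1.comp hg.2.1, ?_⟩
  · rw [Equiv.Perm.mul_apply, hg.1 p hp, hf.1 p hp]
  obtain ⟨B, hBA, hfB, hB⟩ := hf.2.2
  obtain ⟨B', hBA', hgB', hB'⟩ := hg.2.2
  refine ⟨B' ∪ B.image ⇑g⁻¹, ?_, ?_, ?_⟩
  · intro p hp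
    rcases Finset.mem_union.1 hp with h | h
    · exact hBA' h
    · obtain ⟨b, hb, rfl⟩ := Finset.mem_image.1 h
      refine ⟨?_, hg.inv_map_Icc (hBA hb).2⟩
      rw [← hg.map_mem_iff hL hA, perm_apply_inv g]
      exact (hBA hb).1
  · intro p hp
    rw [Equiv.Perm.mul_apply, hf.map_mem_iff hL hA, hg.map_mem_iff hL hA]
    rcases Finset.mem_union.1 hp with h | h
    · exact (hBA' h).1
    · obtain ⟨b, hb, rfl⟩ := Finset.mem_image.1 h
      rw [← hg.map_mem_iff hL hA, perm_apply_inv g]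
      exact (hBA hb).1
  · intro p hp
    rw [Finset.mem_coe, Finset.mem_union, not_or] at hp
    obtain ⟨k', hk', m', h'⟩ := locallyAffine_iff.1 (hB' p hp.1)
    obtain ⟨k, hk, m, h⟩ := locallyAffine_iff.1 (hB (g p) fun h =>
      hp.2 (Finset.mem_image.2 ⟨_, h, perm_inv_apply g p⟩))
    refine locallyAffine_iff.2 ⟨k * k', hL.2.2.1 k hk k' hk', k * m' + m, ?_⟩
    filter_upwards [h', hg.2.1.continuousAt.eventually h] with q hq hq'
    rw [Equiv.Perm.mul_apply, hq', hq]
    ring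

theorem inv (hL : IsSlopeSubgroup L) (hf : memF r L A f) : memF r L A f⁻¹ := by
  refine ⟨fun p hp => hf.inv_apply_eq_self hp, hf.continuous_inv, ?_⟩
  obtain ⟨B, hBA, hfB, hB⟩ := hf.2.2
  refine ⟨B.image f, ?_, ?_, ?_⟩
  · intro p hp
    obtain ⟨b, hb, rfl⟩ := Finset.mem_image.1 hp
    exact ⟨hfB b hb, hf.map_Icc (hBA hb).2⟩
  · intro p hp
    obtain ⟨b, hb, rfl⟩ := Finset.mem_image.1 hp
    rw [perm_inv_apply]
    exact (hBA hb).1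
  · intro p hp
    obtain ⟨k, hk, m, h⟩ := locallyAffine_iff.1 (hB (f⁻¹ p) fun h =>
      hp (Finset.mem_image.2 ⟨_, h, perm_apply_inv f p⟩))
    refine locallyAffine_iff.2 ⟨k⁻¹, hL.2.2.2 k hk, -(k⁻¹ * m), ?_⟩
    have hk0 := hL.1 k hk
    filter_upwards [hf.continuous_inv.continuousAt.eventually h] with q hq
    rw [perm_apply_inv] at hq
    field_simp
    linarith

theorem pow (hL : IsSlopeSubgroup L) (hA : IsSlopeModule r L A) (hf : memF r L A f) (n : ℕ) :
    memF r L A (f ^ n) := by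
  induction n with
  | zero => exact one hL
  | succ n ih => exact pow_succ f n ▸ ih.mul hL hA hf

end memF

namespace memFS

variable {r : ℝ} {L A : Set ℝ} {S : Set ℝ} {f g : Equiv.Perm ℝ}

theorem apply_eq_self (hf : memFS r L A S f) {p : ℝ} (hp : p ∉ S) : f p = p := by
  by_contra h
  exact hp (hf.2 h)

theorem one (hL : IsSlopeSubgroup L) : memFS r L A S 1 :=
  ⟨memF.one hL, fun _ h => absurd rfl h⟩

theorem mul (hL : IsSlopeSubgroup L) (hA : IsSlopeModule r L A) (hf : memFS r L A S f)
    (hg : memFS r L A S g) : memFS r L A S (f * g) := by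
  refine ⟨hf.1.mul hL hA hg.1, fun p hp => ?_⟩
  by_contra h
  exact hp (by rw [Equiv.Perm.mul_apply, hg.apply_eq_self h, hf.apply_eq_self h])

theorem inv (hL : IsSlopeSubgroup L) (hf : memFS r L A S f) : memFS r L A S f⁻¹ := by
  refine ⟨hf.1.inv hL, fun p hp => ?_⟩
  by_contra h
  exact hp (by rw [Equiv.Perm.inv_eq_iff_eq, hf.apply_eq_self h])

end memFS

namespace HasSlopeToward

variable {e p k l : ℝ} {f g : Equiv.Perm ℝ}

theorem mul (hk : 0 < k) (hf : HasSlopeToward e f p k) (hg : HasSlopeToward e g (f p) l) :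
    HasSlopeToward e ⇑(g * f) p (l * k) := by
  obtain ⟨δ, hδ, hf⟩ := hf
  obtain ⟨δ', hδ', hg⟩ := hg
  refine ⟨min δ (δ' / k), lt_min hδ (by positivity), fun w hw => ?_⟩
  have hw2 : w * k ≤ δ' := (le_div_iff₀ hk).1 (hw.2.trans (min_le_right _ _))
  rw [Equiv.Perm.mul_apply, hf w ⟨hw.1, hw.2.trans (min_le_left _ _)⟩,
    hg _ ⟨mul_nonneg hk.le hw.1, by linarith⟩, mul_assoc l, Equiv.Perm.mul_apply]

theorem inv (hk : 0 < k) (hf : HasSlopeToward e f p k) :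
    HasSlopeToward e ⇑f⁻¹ (f p) k⁻¹ := by
  obtain ⟨δ, hδ, hf⟩ := hf
  refine ⟨k * δ, by positivity, fun w hw => ?_⟩
  have := hf (k⁻¹ * w) ⟨mul_nonneg (by positivity) hw.1, by
    rw [inv_mul_le_iff₀ hk]; exact hw.2⟩
  rw [Equiv.Perm.inv_eq_iff_eq, perm_inv_apply, this, mul_inv_cancel_left₀ hk.ne']

theorem eq_of_commute {s δ : ℝ} (hfg : Commute f g) (hδ : 0 < δ) (hk0 : 0 < k) (hk1 : k < 1)
    (hf : ∀ w ∈ Icc 0 δ, f (p + e * w) = p + e * (k * w)) (hs0 : 0 < s) (hs1 : s ≤ 1)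
    (hgp : g p = p) (hg : HasSlopeToward e g p s) :
    ∀ w ∈ Icc 0 δ, g (p + e * w) = p + e * (s * w) := by
  obtain ⟨δ', hδ', hg⟩ := hg
  rw [hgp] at hg
  have hpow : ∀ n : ℕ, ∀ w ∈ Icc 0 δ, (f ^ n) (p + e * w) = p + e * (k ^ n * w) := by
    intro n w hw
    induction n with
    | zero => simp
    | succ n ih =>
      have h1 : k ^ n * w ≤ 1 * w := mul_le_mul_of_nonneg_right (pow_le_one₀ hk0.le hk1.le) hw.1
      rw [pow_succ', Equiv.Perm.mul_apply, ih,
        hf _ ⟨mul_nonneg (by positivity) hw.1, by linarith [hw.2]⟩]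
      ring
  obtain ⟨n, hn⟩ := exists_pow_lt_of_lt_one (div_pos hδ' hδ) hk1
  rw [lt_div_iff₀ hδ] at hn
  intro w hw
  have hkn : 0 < k ^ n := by positivity
  have hsw : s * w ∈ Icc 0 δ :=
    ⟨mul_nonneg hs0.le hw.1, (mul_le_of_le_one_left hw.1 hs1).trans hw.2⟩
  apply (f ^ n).injective
  rw [hpow n _ hsw, ← Equiv.Perm.mul_apply, (hfg.pow_left n).eq, Equiv.Perm.mul_apply, hpow n w hw,
    hg _ ⟨mul_nonneg hkn.le hw.1, (mul_le_mul_of_nonneg_left hw.2 hkn.le).trans hn.le⟩]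
  ring

end HasSlopeToward

theorem apply_comm {x y : Equiv.Perm ℝ} (h : Commute x y) (p : ℝ) : x (y p) = y (x p) :=
  congrArg (fun z : Equiv.Perm ℝ => z p) h.eq

theorem exists_mem_Ioo_of_isSlopeModule {r : ℝ} {L A : Set ℝ} (hr : 0 < r)
    (hL : IsSlopeSubgroup L) (hLne : L ≠ {1}) (hA : IsSlopeModule r L A) {a b : ℝ} (hab : a < b) :
    ∃ c ∈ A, c ∈ Ioo a b := by
  obtain ⟨hrA, h0, hadd, hneg, hmul⟩ := hA
  obtain ⟨hpos, hone, hmulL, hinv⟩ := hL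
  obtain ⟨q, hq, hq1⟩ : ∃ q ∈ L, q < 1 := by
    by_contra! h
    refine hLne (Subset.antisymm (fun p hp => ?_) (singleton_subset_iff.2 hone))
    have := (one_le_inv₀ (hpos p hp)).1 (h _ (hinv p hp))
    exact le_antisymm this (h p hp)
  have hqA : ∀ n : ℕ, q ^ n * r ∈ A := by
    intro n
    induction n with
    | zero => simpa using hrA
    | succ n ih =>
      rw [pow_succ', mul_assoc]
      exact hmul q hq _ ih
  let A' : AddSubgroup ℝ :=
    { carrier := A
      zero_mem' := h0
      add_mem' := fun ha hb => hadd _ ha _ hb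
      neg_mem' := fun ha => hneg _ ha }
  have hd : Dense (A' : Set ℝ) := by
    refine AddSubgroup.dense_of_not_isolated_zero A' fun ε hε => ?_
    obtain ⟨n, hn⟩ := exists_pow_lt_of_lt_one (div_pos hε hr) hq1
    have := hpos q hq
    exact ⟨q ^ n * r, hqA n, by positivity, (lt_div_iff₀ hr).1 hn⟩
  exact hd.exists_between hab

section Centralizer

variable {r : ℝ} {L A : Set ℝ} {α β : ℝ} {x y : Equiv.Perm ℝ}

theorem eq_one_of_hasSlopeToward_one (hL : IsSlopeSubgroup L) (hαβ : α < β)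
    (hx : memFS r L A (Ioo α β) x) (hxfix : ∀ p ∈ Ioo α β, x p = p → p ∉ A)
    (hy : memFS r L A (Ioo α β) y) (hxy : Commute x y) (hslope : HasSlopeToward 1 y α 1) :
    y = 1 := by
  have hyα : y α = α := hy.apply_eq_self (by simp)
  set S : Set ℝ := {p | p ≤ β ∧ ∀ q ∈ Icc α p, y q = q} with hS
  have hSb : BddAbove S := ⟨β, fun p hp => hp.1⟩
  have hSα : ∃ p ∈ S, α < p := by
    obtain ⟨δ, hδ, h⟩ := hslope
    refine ⟨min (α + δ) β, ⟨min_le_right _ _, fun q hq => ?_⟩, lt_min (by linarith) hαβ⟩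
    have := h (q - α) ⟨by linarith [hq.1], by linarith [hq.2.trans (min_le_left _ _)]⟩
    rw [hyα] at this
    simpa using this
  obtain ⟨p₀, hp₀, hαp₀⟩ := hSα
  set σ := sSup S with hσ
  have hασ : α < σ := hαp₀.trans_le (le_csSup hSb hp₀)
  have hσβ : σ ≤ β := csSup_le ⟨p₀, hp₀⟩ fun p hp => hp.1
  have hid : Icc α σ ⊆ {q | y q = q} := by
    rw [← closure_Ico hασ.ne]
    refine closure_minimal (fun q hq => ?_) (isClosed_eq hy.1.2.1 continuous_id)
    obtain ⟨p, hp, hqp⟩ := exists_lt_of_lt_csSup ⟨p₀, hp₀⟩ hq.2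
    exact hp.2 q ⟨hq.1, hqp.le⟩
  have hmax : ∀ p, p ≤ β → σ < p → ¬ ∀ q ∈ Icc α p, y q = q := fun p hp hσp h =>
    hσp.not_ge (le_csSup hSb ⟨hp, h⟩)
  rcases hσβ.eq_or_lt with hσ' | hσ'
  · ext q
    by_cases hq : q ∈ Ioo α β
    · exact hid ⟨hq.1.le, hσ' ▸ hq.2.le⟩
    · exact hy.apply_eq_self hq
  exfalso
  have hmove : ∀ z : Equiv.Perm ℝ, memFS r L A (Ioo α β) z → Commute z y → ¬ σ < z σ := by
    intro z hz hzy hzσ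
    have hzβ : z β = β := hz.apply_eq_self (by simp)
    have hzα : z α = α := hz.apply_eq_self (by simp)
    refine hmax (z σ) (hzβ ▸ hz.1.strictMono.monotone hσβ) hzσ fun q hq => ?_
    have hq' : z⁻¹ q ∈ Icc α σ := by
      rw [← perm_apply_inv z q] at hq
      constructor
      · rw [← hz.1.strictMono.le_iff_le, hzα]; exact hq.1
      · rw [← hz.1.strictMono.le_iff_le]; exact hq.2
    have h1 := apply_comm hzy (z⁻¹ q)
    have h2 : y (z⁻¹ q) = z⁻¹ q := hid hq'
    rw [h2, perm_apply_inv] at h1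
    exact h1.symm
  rcases lt_trichotomy (x σ) σ with h | h | h
  · refine hmove x⁻¹ (hx.inv hL) hxy.inv_left ?_
    rwa [← hx.1.strictMono.lt_iff_lt, perm_apply_inv]
  · obtain ⟨B, hBA, -, hB⟩ := hy.1.2.2
    obtain ⟨ε, hε, k, -, m, hkm⟩ := hB σ fun hσB => hxfix σ ⟨hασ, hσ'⟩ h (hBA hσB).1
    have h1 : y σ = σ := hid ⟨hασ.le, le_rfl⟩
    have h2 : max α (σ - ε / 2) < σ := max_lt hασ (by linarith)
    have h3 : y (max α (σ - ε / 2)) = max α (σ - ε / 2) := hid ⟨le_max_left _ _, h2.le⟩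
    have h4 := le_max_right α (σ - ε / 2)
    rw [hkm _ ⟨by linarith, by linarith⟩] at h1 h3
    have hk : k = 1 := by
      have : (k - 1) * (σ - max α (σ - ε / 2)) = 0 := by linarith
      rcases mul_eq_zero.1 this with h | h <;> linarith
    subst hk
    have hm : m = 0 := by linarith
    subst hm
    refine hmax (min β (σ + ε / 2)) (min_le_left _ _) (lt_min hσ' (by linarith)) fun q hq => ?_
    rcases le_or_gt q σ with h | h
    · exact hid ⟨hq.1, h⟩
    · rw [hkm q ⟨by linarith, by linarith [hq.2.trans (min_le_right _ _)]⟩]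
      ring
  · exact hmove x hx hxy h

theorem exists_pow_apply_lt {γ δ : ℝ} (hx : Continuous x) (hxα : x α = α) (hmono : StrictMono x)
    (hlt : ∀ p ∈ Ioo α γ, x p < p) (hδ : 0 < δ) {p : ℝ} (hp : p ∈ Ioo α γ) :
    ∃ n : ℕ, (x ^ n) p ∈ Ioo α (α + δ) := by
  have hmem : ∀ n : ℕ, (x ^ n) p ∈ Ioo α γ := by
    intro n
    induction n with
    | zero => exact hp
    | succ n ih =>
      rw [pow_succ', Equiv.Perm.mul_apply]
      exact ⟨hxα ▸ hmono ih.1, (hlt _ ih).trans ih.2⟩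
  by_contra! h
  have hge : ∀ n : ℕ, α + δ ≤ (x ^ n) p := fun n => by
    by_contra! h'
    exact h n ⟨(hmem n).1, h'⟩
  have hanti : Antitone fun n : ℕ => (x ^ n) p := by
    refine antitone_nat_of_succ_le fun n => ?_
    rw [pow_succ', Equiv.Perm.mul_apply]
    exact (hlt _ (hmem n)).le
  have hlim := tendsto_atTop_ciInf hanti ⟨α + δ, by rintro _ ⟨n, rfl⟩; exact hge n⟩
  set l := ⨅ n : ℕ, (x ^ n) p
  have hl1 : α + δ ≤ l := ge_of_tendsto' hlim hge
  have hl2 : l ≤ p := le_of_tendsto' hlim fun n => hanti (Nat.zero_le n)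
  have hfix : x l = l := isFixedPt_of_tendsto_iterate (f := x) (x := p)
    (by simpa only [Equiv.Perm.iterate_eq_pow] using hlim) hx.continuousAt
  exact (hlt l ⟨by linarith, hl2.trans_lt hp.2⟩).ne hfix

theorem exists_slope_gap (hL : IsSlopeSubgroup L) (hA : IsSlopeModule r L A) (hαβ : α < β)
    (hx : memFS r L A (Ioo α β) x) {k : ℝ} (hk0 : 0 < k) (hk1 : k < 1)
    (hxk : HasSlopeToward 1 x α k) :
    ∃ s₀ < 1, ∀ y, memFS r L A (Ioo α β) y → Commute x y → ∀ s > s₀, 0 < s →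
      HasSlopeToward 1 y α s → 1 ≤ s := by
  have hfixα : ∀ z, memFS r L A (Ioo α β) z → z α = α := fun z hz => hz.apply_eq_self (by simp)
  have hxβ : x β = β := hx.apply_eq_self (by simp)
  have hmono := hx.1.strictMono
  obtain ⟨δ, hδ, hxδ⟩ := hxk
  rw [hfixα x hx] at hxδ
  have hsmall : ∀ p, α < p → p ≤ α + δ → x p < p := fun p hp hp' => by
    have h := hxδ (p - α) ⟨by linarith, by linarith⟩
    rw [one_mul, one_mul, add_sub_cancel] at h
    have := mul_lt_of_lt_one_left (sub_pos.2 hp) hk1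
    linarith
  have hδβ : α + δ < β := by
    by_contra! h
    exact (hsmall β hαβ h).ne hxβ
  -- `γ` is the first point to the right of `α` that `x` does not move to the left
  obtain ⟨γ, ⟨hγ1, hγ2⟩, hγmin⟩ : ∃ γ, IsLeast (Icc (α + δ) β ∩ {p | p ≤ x p}) γ :=
    (isCompact_Icc.inter_right (isClosed_le continuous_id hx.1.2.1)).exists_isLeast
      ⟨β, ⟨hδβ.le, le_rfl⟩, hxβ.ge⟩
  have hαγ : α < γ := by linarith [hγ1.1]
  have hlt : ∀ p ∈ Ioo α γ, x p < p := fun p hp => by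
    rcases le_or_gt p (α + δ) with h | h
    · exact hsmall p hp.1 h
    · by_contra! h'
      exact (hγmin ⟨⟨h.le, hp.2.le.trans hγ1.2⟩, h'⟩).not_gt hp.2
  have hmin : ∀ p, α < p → p ≤ x p → γ ≤ p := fun p hp h => by
    by_contra! h'
    exact (hlt p ⟨hp, h'⟩).not_ge h
  have hfixγ : ∀ y, memFS r L A (Ioo α β) y → Commute x y → γ ≤ y γ := fun y hy hxy => by
    refine hmin _ (hfixα y hy ▸ hy.1.strictMono hαγ) ?_
    rw [apply_comm hxy]
    exact hy.1.strictMono.monotone hγ2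
  have hfixγ' : ∀ y, memFS r L A (Ioo α β) y → Commute x y → y γ = γ := fun y hy hxy => by
    refine le_antisymm ?_ (hfixγ y hy hxy)
    have := hy.1.strictMono.monotone (hfixγ y⁻¹ (hy.inv hL) hxy.inv_right)
    rwa [perm_apply_inv] at this
  have hxγ := hfixγ' x hx rfl
  have hxinvγ : x⁻¹ γ = γ := by rw [Equiv.Perm.inv_eq_iff_eq, hxγ]
  -- a point with image under a power of `x` in the linear region near `α`
  obtain ⟨l, hl, δ', hδ', hxδ'⟩ := ((hx.1.inv hL).exists_hasSlopeToward γ).2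
  rw [hxinvγ] at hxδ'
  have hl0 := hL.1 l hl
  obtain ⟨η, hη0, hηδ, hηγ⟩ : ∃ η > 0, η ≤ δ' ∧ η < γ - α :=
    ⟨min δ' ((γ - α) / 2), lt_min hδ' (by linarith), min_le_left _ _,
      (min_le_right _ _).trans_lt (by linarith)⟩
  have hl1 : l < 1 := by
    have h1 := hxδ' η ⟨hη0.le, hηδ⟩
    have h2 := hlt (γ + -1 * (l * η))
    rw [← h1, perm_apply_inv, h1] at h2
    by_contra! h
    have h3 : η ≤ l * η := le_mul_of_one_le_left hη0.le h
    have h4 := hlt (γ + -1 * η) ⟨by linarith, by linarith⟩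
    have h5 := hmono.lt_iff_lt.2 h4
    have h6 := hmono.monotone (show γ + -1 * (l * η) ≤ γ + -1 * η by linarith)
    rw [← h1, perm_apply_inv] at h6
    linarith
  set p₀ := γ - η with hp₀
  obtain ⟨N, hN⟩ := exists_pow_apply_lt hx.1.2.1 (hfixα x hx) hmono hlt hδ
    (p := p₀) ⟨by linarith, by linarith⟩
  have hφ := hx.1.pow hL hA N
  obtain ⟨u, hu, ε, hε, hφε⟩ := (hφ.exists_hasSlopeToward p₀).1
  have hu0 := hL.1 u hu
  set φ := x ^ N with hφdef
  obtain ⟨ζ, hζ0, hζε, hζη, hζδ⟩ : ∃ ζ > 0, ζ ≤ ε ∧ ζ < η ∧ u * ζ < α + δ - φ p₀ := by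
    refine ⟨min (min ε (η / 2)) ((α + δ - φ p₀) / u / 2), ?_, ?_, ?_, ?_⟩
    · have : 0 < α + δ - φ p₀ := by linarith [hN.2]
      positivity
    · exact (min_le_left _ _).trans (min_le_left _ _)
    · exact ((min_le_left _ _).trans (min_le_right _ _)).trans_lt (by linarith)
    · have : 0 < α + δ - φ p₀ := by linarith [hN.2]
      calc u * _ ≤ u * ((α + δ - φ p₀) / u / 2) :=
            mul_le_mul_of_nonneg_left (min_le_right _ _) hu0.le
        _ = (α + δ - φ p₀) / 2 := by field_simp
        _ < _ := by linarith
  have hφlin : ∀ p ∈ Icc p₀ (p₀ + ζ), φ p = φ p₀ + u * (p - p₀) := fun p hp => by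
    have := hφε (p - p₀) ⟨by linarith [hp.1], by linarith [hp.2]⟩
    simpa using this
  have huζ : 0 < u * ζ := by positivity
  have hφα : 0 < φ p₀ - α := by linarith [hN.1]
  have hφζ := hφlin (p₀ + ζ) ⟨by linarith, le_rfl⟩
  rw [add_sub_cancel_left] at hφζ
  refine ⟨(φ p₀ - α) / (φ p₀ + u * ζ - α), by rw [div_lt_one (by linarith)]; linarith, ?_⟩
  intro y hy hxy s hs hs0 hys
  by_contra! hs1
  rw [gt_iff_lt, div_lt_iff₀ (by linarith)] at hs
  have hyα := hfixα y hy
  have hyγ := hfixγ' y hy hxy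
  have hyinvγ : y⁻¹ γ = γ := by rw [Equiv.Perm.inv_eq_iff_eq, hyγ]
  have hylin : ∀ p ∈ Icc α (α + δ), y p = α + s * (p - α) := fun p hp => by
    have := HasSlopeToward.eq_of_commute hxy hδ hk0 hk1 hxδ hs0 hs1.le hyα hys (p - α)
      ⟨by linarith [hp.1], by linarith [hp.2]⟩
    simpa using this
  have hylt : ∀ p ∈ Ioo α γ, y p < p := fun p hp => by
    obtain ⟨n, hn⟩ := exists_pow_apply_lt hx.1.2.1 (hfixα x hx) hmono hlt hδ hp
    have h := apply_comm (hxy.pow_left n) p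
    rw [hylin _ ⟨hn.1.le, hn.2.le⟩] at h
    rw [← (hx.1.pow hL hA n).strictMono.lt_iff_lt, h]
    have := mul_lt_of_lt_one_left (sub_pos.2 hn.1) hs1
    linarith
  obtain ⟨t, ht, δ'', hδ'', hyt⟩ := ((hy.1.inv hL).exists_hasSlopeToward γ).2
  have ht0 := hL.1 t ht
  have ht1 : t ≤ 1 := by
    by_contra! h
    rw [hyinvγ] at hyt
    obtain ⟨w, hw0, hwδ, hwγ⟩ : ∃ w > 0, w ≤ δ'' ∧ w < γ - α :=
      ⟨min δ'' ((γ - α) / 2), lt_min hδ'' (by linarith), min_le_left _ _,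
        (min_le_right _ _).trans_lt (by linarith)⟩
    have h1 := hyt w ⟨hw0.le, hwδ⟩
    have h2 := hylt (γ + -1 * w) ⟨by linarith, by linarith⟩
    have h3 : w < t * w := lt_mul_of_one_lt_left hw0 h
    have h4 := hy.1.strictMono (show γ + -1 * (t * w) < γ + -1 * w by linarith)
    rw [← h1, perm_apply_inv] at h4
    linarith
  have hyinvlin : ∀ p ∈ Icc p₀ γ, y⁻¹ p = γ - t * (γ - p) := fun p hp => by
    have := HasSlopeToward.eq_of_commute (hxy.inv_left.inv_right) hδ' hl0 hl1 hxδ' ht0 ht1 hyinvγ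
      ⟨δ'', hδ'', hyt⟩ (γ - p) ⟨by linarith [hp.2], by linarith [hp.1]⟩
    rw [show γ + -1 * (γ - p) = p by ring] at this
    rw [this]
    ring
  -- compare the displacements of `y` on the two linear regions
  have hφy : ∀ p, φ (y p) = y (φ p) := apply_comm (hxy.pow_left N)
  have h1 : p₀ < y (p₀ + ζ) := by
    rw [← hφ.strictMono.lt_iff_lt, hφy, hφζ, hylin _ ⟨by linarith, by linarith⟩]
    linarith
  have h2 : y (p₀ + ζ) < p₀ + ζ := hylt _ ⟨by linarith, by linarith⟩
  have h3 : p₀ < y⁻¹ p₀ := by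
    rw [← hy.1.strictMono.lt_iff_lt, perm_apply_inv]
    exact hylt _ ⟨by linarith, by linarith⟩
  have h4 : y⁻¹ p₀ < p₀ + ζ := by
    rwa [← hy.1.strictMono.lt_iff_lt, perm_apply_inv]
  have h5 := hφlin (y (p₀ + ζ)) ⟨h1.le, h2.le⟩
  have h6 := hφlin (y⁻¹ p₀) ⟨h3.le, h4.le⟩
  have h7 := hφy (y⁻¹ p₀)
  have hpos : 0 < u * (y⁻¹ p₀ - p₀) := mul_pos hu0 (by linarith)
  have hpos' : u * (y⁻¹ p₀ - p₀) ≤ u * ζ := mul_le_mul_of_nonneg_left (by linarith) hu0.le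
  rw [perm_apply_inv, h6, hylin _ ⟨by linarith, by linarith⟩] at h7
  rw [hφy, hφζ, hylin _ ⟨by linarith, by linarith⟩] at h5
  have h8 := hyinvlin p₀ ⟨le_rfl, by linarith⟩
  have h9 := hyinvlin (y (p₀ + ζ)) ⟨h1.le, by linarith⟩
  rw [perm_inv_apply] at h9
  have h10 : u * (y (p₀ + ζ) - p₀) = u * (s * (p₀ + ζ - y⁻¹ p₀)) := by linarith
  have h11 := mul_left_cancel₀ hu0.ne' h10
  have h12 : p₀ + ζ - y⁻¹ p₀ = t * (y (p₀ + ζ) - p₀) := by linarith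
  have h13 : s * (p₀ + ζ - y⁻¹ p₀) < p₀ + ζ - y⁻¹ p₀ := mul_lt_of_lt_one_left (by linarith) hs1
  have h14 : t * (y (p₀ + ζ) - p₀) ≤ y (p₀ + ζ) - p₀ := mul_le_of_le_one_left (by linarith) ht1
  linarith

end Centralizer

/-- Let `α, β ∈ [0,r] ∩ A` with `α < β`, `I = (α,β)`, and let
`x ∈ F_I` have no fixed point in `I ∩ A`.  Then the centralizer `C` of `x` in `F_I`
is cyclic: there is `c ∈ C` with `C = ⟨c⟩ = {cⁿ : n ∈ ℤ}`. -/
theorem centralizer_in_FI_cyclic (r : ℝ) (L A : Set ℝ) (hr : 0 < r)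
    (hL : IsSlopeSubgroup L) (hLne : L ≠ {1}) (hA : IsSlopeModule r L A)
    (α β : ℝ) (hα : α ∈ Icc 0 r ∩ A) (hβ : β ∈ Icc 0 r ∩ A) (hαβ : α < β)
    (x : Equiv.Perm ℝ) (hx : memFS r L A (Ioo α β) x)
    (hxfix : {γ | x γ = γ} ∩ Ioo α β ∩ A = ∅) :
    ∃ c : Equiv.Perm ℝ, (memFS r L A (Ioo α β) c ∧ Commute x c) ∧
      {y : Equiv.Perm ℝ | memFS r L A (Ioo α β) y ∧ Commute x y} =
        Set.range fun n : ℤ => c ^ n := by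
  have hfix : ∀ p ∈ Ioo α β, x p = p → p ∉ A := fun p hp hxp hpA =>
    (Set.ext_iff.1 hxfix p).1 ⟨⟨hxp, hp⟩, hpA⟩
  have hgap : ∃ s₀ < 1, ∀ y, memFS r L A (Ioo α β) y → Commute x y → ∀ s > s₀, 0 < s →
      HasSlopeToward 1 y α s → 1 ≤ s := by
    have hxα : x α = α := hx.apply_eq_self (by simp)
    obtain ⟨k, hk, hxk⟩ := (hx.1.exists_hasSlopeToward α).1
    have hk0 := hL.1 k hk
    rcases lt_trichotomy k 1 with h | rfl | h
    · exact exists_slope_gap hL hA hαβ hx hk0 h hxk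
    · obtain ⟨δ, hδ, hxk⟩ := hxk
      obtain ⟨a, haA, ha⟩ := exists_mem_Ioo_of_isSlopeModule hr hL hLne hA
        (lt_min (show α < α + δ by linarith) hαβ)
      have := hxk (a - α) ⟨by linarith [ha.1], by linarith [ha.2.trans_le (min_le_left _ _)]⟩
      rw [hxα] at this
      exact absurd haA (hfix a ⟨ha.1, ha.2.trans_le (min_le_right _ _)⟩ (by simpa using this))
    · have hxk' := hxk.inv hk0
      rw [hxα] at hxk'
      obtain ⟨s₀, hs₀, h'⟩ := exists_slope_gap hL hA hαβ (hx.inv hL) (inv_pos.2 hk0)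
        (inv_lt_one_of_one_lt₀ h) hxk'
      exact ⟨s₀, hs₀, fun y hy hxy => h' y hy hxy.inv_left⟩
  obtain ⟨s₀, hs₀, hgap⟩ := hgap
  let T : AddSubgroup (Additive (Equiv.Perm ℝ) × ℝ) :=
    { carrier := {z | memFS r L A (Ioo α β) z.1.toMul ∧ Commute x z.1.toMul ∧
        HasSlopeToward 1 z.1.toMul α (Real.exp z.2)}
      zero_mem' := ⟨memFS.one hL, Commute.one_right x, 1, one_pos, fun w _ => by simp⟩
      add_mem' := by
        rintro ⟨y, s⟩ ⟨z, t⟩ ⟨hy, hxy, hys⟩ ⟨hz, hxz, hzt⟩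
        refine ⟨hy.mul hL hA hz, hxy.mul_right hxz, ?_⟩
        have := hzt.mul (Real.exp_pos t) (g := y.toMul) (l := Real.exp s)
          (by rwa [hz.apply_eq_self (by simp)])
        rwa [← Real.exp_add] at this
      neg_mem' := by
        rintro ⟨y, s⟩ ⟨hy, hxy, hys⟩
        refine ⟨hy.inv hL, hxy.inv_right, ?_⟩
        have := hys.inv (Real.exp_pos s)
        rwa [← Real.exp_neg, hy.apply_eq_self (by simp)] at this }
  have hcyc : ∃ a, T.map (AddMonoidHom.snd _ _) = AddSubgroup.closure {a} := by
    refine (AddSubgroup.dense_or_cyclic _).resolve_left fun hd => ?_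
    have h0 : max s₀ 0 < 1 := max_lt hs₀ one_pos
    obtain ⟨t, ht, hmem⟩ := hd.exists_mem_open
      ((isOpen_Ioo (a := max s₀ 0) (b := 1)).preimage Real.continuous_exp)
      ⟨Real.log ((max s₀ 0 + 1) / 2), by
        rw [mem_preimage, Real.exp_log (by linarith [le_max_right s₀ 0])]
        exact ⟨by linarith, by linarith⟩⟩
    obtain ⟨⟨y, s⟩, ⟨hy, hxy, hys⟩, rfl⟩ := ht
    exact hmem.2.not_ge (hgap _ hy hxy _ ((le_max_left _ _).trans_lt hmem.1) (Real.exp_pos _) hys)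
  obtain ⟨a, ha⟩ := hcyc
  obtain ⟨⟨c, a'⟩, hc, haa'⟩ : a ∈ T.map (AddMonoidHom.snd _ _) :=
    ha ▸ AddSubgroup.mem_closure_singleton_self a
  obtain rfl : a' = a := haa'
  refine ⟨c.toMul, ⟨hc.1, hc.2.1⟩, Subset.antisymm ?_ ?_⟩
  · rintro y ⟨hy, hxy⟩
    obtain ⟨k, hk, hyk⟩ := (hy.1.exists_hasSlopeToward α).1
    have hyT : (Additive.ofMul y, Real.log k) ∈ T :=
      ⟨hy, hxy, by rwa [Real.exp_log (hL.1 k hk)]⟩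
    have hlog : Real.log k ∈ T.map (AddMonoidHom.snd _ _) := ⟨_, hyT, rfl⟩
    rw [ha, AddSubgroup.mem_closure_singleton] at hlog
    obtain ⟨n, hn⟩ := hlog
    obtain ⟨h1, h2, h3⟩ := T.sub_mem hyT (T.zsmul_mem hc n)
    rw [Prod.snd_sub, Prod.smul_snd, hn, sub_self, Real.exp_zero] at h3
    have h4 := eq_one_of_hasSlopeToward_one hL hαβ hx hfix h1 h2 h3
    exact ⟨n, (div_eq_one.1 h4).symm⟩
  · rintro _ ⟨n, rfl⟩
    have h := T.zsmul_mem hc n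
    exact ⟨h.1, h.2.1⟩
end

section
/- Let a ∈ F↑ with supp(a) = (0,r), let α₀ ∈ (0,r) ∩ A, set αₖ = aᵏ(α₀) for k ∈ ℤ, and let b ∈ F↑ with supp(b) = (α₀,α₁). Let d ∈ F_{(α₀,α₁)} be a generator of the centralizer of b in F_{(α₀,α₁)}. Then the centralizer in F of the set {a⁻ᵏ b aᵏ : k ∈ ℤ} equals the subgroup generated by {a⁻ᵏ d aᵏ : k ∈ ℤ}. -/
open Set

theorem AffOn.hasDerivAt {f : ℝ → ℝ} {x ε k : ℝ}
    (h : AffOn f (Ioo (x - ε) (x + ε)) k) {t : ℝ} (ht : t ∈ Ioo (x - ε) (x + ε)) :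
    HasDerivAt f k t := by
  obtain ⟨m, hm⟩ := h
  have h1 : HasDerivAt (fun u : ℝ => k * u + m) k t := by
    simpa using ((hasDerivAt_id t).const_mul k).add_const m
  exact h1.congr_of_eventuallyEq (Filter.eventuallyEq_of_mem (isOpen_Ioo.mem_nhds ht) hm)

/-- `f` is affine near `x`, with slope in `L`. -/
def LocAff (L : Set ℝ) (f : ℝ → ℝ) (x : ℝ) : Prop :=
  ∃ ε > 0, ∃ k ∈ L, AffOn f (Ioo (x - ε) (x + ε)) k

theorem locAff_iff {L : Set ℝ} {f : ℝ → ℝ} {x : ℝ} :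
    LocAff L f x ↔ ∃ k ∈ L, ∃ m, ∀ᶠ t in nhds x, f t = k * t + m := by
  constructor
  · rintro ⟨ε, hε, k, hk, m, hm⟩
    exact ⟨k, hk, m, Filter.eventually_of_mem (Ioo_mem_nhds (by linarith) (by linarith)) hm⟩
  · rintro ⟨k, hk, m, hm⟩
    obtain ⟨ε, hε, h⟩ := Metric.eventually_nhds_iff_ball.1 hm
    rw [Real.ball_eq_Ioo] at h
    exact ⟨ε, hε, k, hk, m, h⟩

theorem LocAff.differentiableAt {L : Set ℝ} {f : ℝ → ℝ} {x : ℝ} (h : LocAff L f x) :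
    DifferentiableAt ℝ f x := by
  obtain ⟨ε, hε, k, -, hk⟩ := h
  exact (hk.hasDerivAt ⟨by linarith, by linarith⟩).differentiableAt

theorem LocAff.deriv_mem {L : Set ℝ} {f : ℝ → ℝ} {x : ℝ} (h : LocAff L f x) :
    deriv f x ∈ L := by
  obtain ⟨ε, hε, k, hkL, hk⟩ := h
  rwa [(hk.hasDerivAt ⟨by linarith, by linarith⟩).deriv]

theorem LocAff.hasDerivAt_deriv {L : Set ℝ} {f : ℝ → ℝ} {x : ℝ} (h : LocAff L f x) :
    HasDerivAt (deriv f) 0 x := by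
  obtain ⟨ε, hε, k, -, hk⟩ := h
  refine (hasDerivAt_const x k).congr_of_eventuallyEq ?_
  exact Filter.eventuallyEq_of_mem (Ioo_mem_nhds (by linarith) (by linarith))
    fun t ht => (hk.hasDerivAt ht).deriv

theorem LocAff.congr {L : Set ℝ} {f g : ℝ → ℝ} {x : ℝ} (h : LocAff L f x)
    (hfg : g =ᶠ[nhds x] f) : LocAff L g x := by
  rw [locAff_iff] at h ⊢
  obtain ⟨k, hk, m, hm⟩ := h
  exact ⟨k, hk, m, by filter_upwards [hm, hfg] with t h1 h2; rw [h2, h1]⟩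

theorem locAff_id {L : Set ℝ} (hL : IsSlopeSubgroup L) (x : ℝ) : LocAff L (fun t => t) x :=
  locAff_iff.2 ⟨1, hL.2.1, 0, by simp⟩

theorem LocAff.comp {L : Set ℝ} (hL : IsSlopeSubgroup L) {f g : ℝ → ℝ} {x : ℝ}
    (hf : LocAff L f (g x)) (hg : LocAff L g x) : LocAff L (fun t => f (g t)) x := by
  have hc := hg.differentiableAt.continuousAt
  rw [locAff_iff] at *
  obtain ⟨k, hk, m, hm⟩ := hf
  obtain ⟨l, hl, n, hn⟩ := hg
  refine ⟨k * l, hL.2.2.1 k hk l hl, k * n + m, ?_⟩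
  filter_upwards [hc.eventually hm, hn] with t h1 h2
  rw [h1, h2]; ring

theorem LocAff.symm {L : Set ℝ} (hL : IsSlopeSubgroup L) {f : Equiv.Perm ℝ} {x : ℝ}
    (hc : ContinuousAt f.symm (f x)) (hf : LocAff L f x) : LocAff L f.symm (f x) := by
  rw [locAff_iff] at *
  obtain ⟨k, hk, m, hm⟩ := hf
  have hk0 := hL.1 k hk
  refine ⟨k⁻¹, hL.2.2.2 k hk, -(k⁻¹ * m), ?_⟩
  rw [ContinuousAt, Equiv.symm_apply_apply] at hc
  filter_upwards [hc.eventually hm] with t ht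
  rw [Equiv.apply_symm_apply] at ht
  have h1 : f.symm t = k⁻¹ * (t - m) := by
    rw [eq_inv_mul_iff_mul_eq₀ hk0.ne']; linarith
  rw [h1]; ring

/-- A function affine near every point of an interval, with two fixed points there,
is the identity on that interval. -/
theorem eq_self_of_locAff {L : Set ℝ} {f : ℝ → ℝ} {p q u v : ℝ}
    (h : ∀ x ∈ Ioo p q, LocAff L f x) (hu : u ∈ Ioo p q) (hv : v ∈ Ioo p q) (huv : u < v)
    (hfu : f u = u) (hfv : f v = v) {x : ℝ} (hx : x ∈ Ioo p q) : f x = x := by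
  have hconst : ∀ s ∈ Ioo p q, ∀ t ∈ Ioo p q, deriv f s = deriv f t := fun s hs t ht =>
    isOpen_Ioo.is_const_of_deriv_eq_zero isPreconnected_Ioo
      (fun z hz => (h z hz).hasDerivAt_deriv.differentiableAt.differentiableWithinAt)
      (fun z hz => (h z hz).hasDerivAt_deriv.deriv) hs ht
  have hsub : Icc u v ⊆ Ioo p q := fun z hz => ⟨hu.1.trans_le hz.1, hz.2.trans_lt hv.2⟩
  obtain ⟨c, hc, hcs⟩ := exists_deriv_eq_slope f huv
    (fun z hz => (h z (hsub hz)).differentiableAt.continuousAt.continuousWithinAt)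
    (fun z hz => (h z (hsub (Ioo_subset_Icc_self hz))).differentiableAt.differentiableWithinAt)
  rw [hfu, hfv, div_self (sub_ne_zero.2 huv.ne')] at hcs
  have hc' := hsub (Ioo_subset_Icc_self hc)
  have hd : ∀ z ∈ Ioo p q, HasDerivAt (fun t => f t - t) 0 z := fun z hz => by
    have h1 := (h z hz).differentiableAt.hasDerivAt
    rw [hconst z hz c hc', hcs] at h1
    have h2 := h1.fun_sub (hasDerivAt_id' z)
    rwa [sub_self] at h2
  have := isOpen_Ioo.is_const_of_deriv_eq_zero isPreconnected_Ioo
    (fun z hz => (hd z hz).differentiableAt.differentiableWithinAt)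
    (fun z hz => (hd z hz).deriv) hx hu
  simp only [hfu, sub_self] at this
  linarith

theorem apply_mem_iff {f : Equiv.Perm ℝ} {S : Set ℝ} (h : ∀ x, x ∉ S → f x = x) (x : ℝ) :
    f x ∈ S ↔ x ∈ S := by
  by_cases hx : x ∈ S
  · refine iff_of_true (by_contra fun h1 => h1 ?_) hx
    rwa [f.injective (h _ h1)]
  · rw [h x hx]

section MemF

variable {r : ℝ} {L A : Set ℝ} {f g : Equiv.Perm ℝ}

theorem memF.strictMono_s9 (hf : memF r L A f) : StrictMono f := by
  refine (hf.2.1.strictMono_of_inj f.injective).resolve_right fun h => ?_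
  have h1 := h (show (-2 : ℝ) < -1 by norm_num)
  rw [hf.1 _ (by simp), hf.1 _ (by simp)] at h1
  norm_num at h1

theorem memF.symm_fixed (hf : memF r L A f) {x : ℝ} (hx : x ∉ Ico 0 r) : f.symm x = x := by
  rw [Equiv.symm_apply_eq, hf.1 x hx]

theorem memF.map_zero_s9 (hr : 0 < r) (hf : memF r L A f) : f 0 = 0 := by
  have h0 : (0 : ℝ) ∈ Ico 0 r := ⟨le_rfl, hr⟩
  refine le_antisymm ?_ ((apply_mem_iff hf.1 0).2 h0).1
  have h1 := (apply_mem_iff (f := f.symm) (fun x hx => hf.symm_fixed hx) 0).2 h0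
  simpa using hf.strictMono_s9.monotone h1.1

theorem memF.map_mem (hr : 0 < r) (hA : IsSlopeModule r L A) (hf : memF r L A f) {x : ℝ}
    (hx : x ∈ A) : f x ∈ A := by
  obtain ⟨B, hBA, hBf, hB⟩ := hf.2.2
  by_cases hxr : x ∈ Ico 0 r
  swap
  · rwa [hf.1 x hxr]
  have hne : ((insert 0 B).filter (· ≤ x)).Nonempty := ⟨0, by simp [hxr.1]⟩
  set p := ((insert 0 B).filter (· ≤ x)).max' hne with hp
  have hmem := Finset.max'_mem _ hne
  rw [← hp, Finset.mem_filter, Finset.mem_insert] at hmem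
  obtain ⟨hpB, hpx⟩ := hmem
  have hpA : p ∈ A ∧ f p ∈ A := by
    rcases hpB with h | h
    · rw [h, hf.map_zero_s9 hr]; exact ⟨hA.2.1, hA.2.1⟩
    · exact ⟨(hBA h).1, hBf p h⟩
  rcases hpx.eq_or_lt with h | h
  · rw [← h]; exact hpA.2
  have hloc : ∀ t ∈ Ioo p x, LocAff L f t := fun t ht => hB t fun htB => by
    have := Finset.le_max' ((insert 0 B).filter (· ≤ x)) t
      (by simp only [Finset.mem_filter, Finset.mem_insert]; exact ⟨Or.inr htB, ht.2.le⟩)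
    exact absurd ht.1 (not_lt.2 this)
  obtain ⟨c, hc, hcs⟩ := exists_deriv_eq_slope f h hf.2.1.continuousOn
    fun z hz => (hloc z hz).differentiableAt.differentiableWithinAt
  have hfx : f x = f p + deriv f c * (x + -p) := by
    rw [hcs]; field_simp [(sub_pos.2 h).ne']; ring
  rw [hfx]
  exact hA.2.2.1 _ hpA.2 _ (hA.2.2.2.2 _ (hloc c hc).deriv_mem _
    (hA.2.2.1 _ hx _ (hA.2.2.2.1 _ hpA.1)))

theorem memF_one (hL : IsSlopeSubgroup L) : memF r L A 1 :=
  ⟨fun _ _ => rfl, continuous_id, ∅, by simp, by simp, fun x _ => locAff_id hL x⟩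

theorem memF.continuous_symm (hf : memF r L A f) : Continuous f.symm :=
  (hf.strictMono_s9.orderIsoOfSurjective f f.surjective).symm.continuous.congr fun x => by
    rw [Equiv.eq_symm_apply]
    exact (hf.strictMono_s9.orderIsoOfSurjective f f.surjective).apply_symm_apply x

theorem memF.map_Icc_s9 (hf : memF r L A f) {x : ℝ} (hx : x ∈ Icc 0 r) : f x ∈ Icc 0 r :=
  (apply_mem_iff (fun y hy => hf.1 y fun h => hy (Ico_subset_Icc_self h)) x).2 hx

theorem memF.inv_s9 (hL : IsSlopeSubgroup L) (hf : memF r L A f) : memF r L A f⁻¹ := by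
  obtain ⟨B, hBA, hBf, hB⟩ := hf.2.2
  refine ⟨fun x hx => hf.symm_fixed hx, hf.continuous_symm, B.image f, ?_, ?_, ?_⟩
  · intro y hy
    obtain ⟨x, hx, rfl⟩ := Finset.mem_image.1 hy
    exact ⟨hBf x hx, hf.map_Icc_s9 (hBA hx).2⟩
  · intro y hy
    obtain ⟨x, hx, rfl⟩ := Finset.mem_image.1 hy
    simpa using (hBA hx).1
  · intro y hy
    obtain ⟨x, rfl⟩ := f.surjective y
    refine LocAff.symm hL hf.continuous_symm.continuousAt (hB x fun hx => hy ?_)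
    exact Finset.mem_image_of_mem f hx

theorem memF.mul_s9 (hr : 0 < r) (hL : IsSlopeSubgroup L) (hA : IsSlopeModule r L A)
    (hf : memF r L A f) (hg : memF r L A g) : memF r L A (f * g) := by
  obtain ⟨B, hBA, hBf, hB⟩ := hf.2.2
  obtain ⟨C, hCA, hCg, hC⟩ := hg.2.2
  refine ⟨fun x hx => ?_, hf.2.1.comp hg.2.1, C ∪ B.image (g⁻¹ : Equiv.Perm ℝ), ?_, ?_, ?_⟩
  · rw [Equiv.Perm.mul_apply, hg.1 x hx, hf.1 x hx]
  · intro y hy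
    rcases Finset.mem_union.1 hy with hy | hy
    · exact hCA hy
    obtain ⟨x, hx, rfl⟩ := Finset.mem_image.1 hy
    exact ⟨(hg.inv_s9 hL).map_mem hr hA (hBA hx).1, (hg.inv_s9 hL).map_Icc_s9 (hBA hx).2⟩
  · intro y hy
    rcases Finset.mem_union.1 hy with hy | hy
    · exact hf.map_mem hr hA (hCg y hy)
    obtain ⟨x, hx, rfl⟩ := Finset.mem_image.1 hy
    simpa using hBf x hx
  · intro x hx
    have hxC : x ∉ (C : Set ℝ) := fun h => hx (Finset.mem_union_left _ h)
    have hxB : g x ∉ (B : Set ℝ) := fun h =>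
      hx (Finset.mem_union_right _ (Finset.mem_image.2 ⟨g x, h, by simp⟩))
    exact LocAff.comp hL (f := f) (hB _ hxB) (hC x hxC)

/-- The group `F(r,L,A)` as a subgroup of the permutations of `ℝ`. -/
def slopeGroup (hr : 0 < r) (hL : IsSlopeSubgroup L) (hA : IsSlopeModule r L A) :
    Subgroup (Equiv.Perm ℝ) where
  carrier := {f | memF r L A f}
  mul_mem' hf hg := hf.mul_s9 hr hL hA hg
  one_mem' := memF_one hL
  inv_mem' hf := hf.inv_s9 hL

theorem memF.zpow (hr : 0 < r) (hL : IsSlopeSubgroup L) (hA : IsSlopeModule r L A)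
    (hf : memF r L A f) (n : ℤ) : memF r L A (f ^ n) :=
  (slopeGroup hr hL hA).zpow_mem hf n

theorem memF.exists_restrict (hL : IsSlopeSubgroup L) (hf : memF r L A f) {p q : ℝ}
    (hp : p ∈ A ∩ Icc 0 r) (hq : q ∈ A ∩ Icc 0 r) (hfp : f p = p) (hfq : f q = q) :
    ∃ g : Equiv.Perm ℝ, memF r L A g ∧ (∀ x ∈ Ico p q, g x = f x) ∧
      ∀ x, x ∉ Ico p q → g x = x := by
  have hmem : ∀ x, f x ∈ Ico p q ↔ x ∈ Ico p q := fun x => by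
    conv_lhs => rw [← hfp, ← hfq]
    rw [mem_Ico, mem_Ico, hf.strictMono_s9.le_iff_le, hf.strictMono_s9.lt_iff_lt]
  set g : Equiv.Perm ℝ := Equiv.Perm.ofSubtype (f.subtypePerm hmem) with hg
  have h1 : ∀ x ∈ Ico p q, g x = f x := fun x hx => by
    rw [hg, Equiv.Perm.ofSubtype_apply_of_mem _ hx]; rfl
  have h2 : ∀ x, x ∉ Ico p q → g x = x := fun x hx =>
    Equiv.Perm.ofSubtype_apply_of_not_mem _ hx
  obtain ⟨B, hBA, hBf, hB⟩ := hf.2.2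
  refine ⟨g, ⟨fun x hx => ?_, ?_, B ∪ {p, q}, ?_, ?_, ?_⟩, h1, h2⟩
  · by_cases h : x ∈ Ico p q
    · rw [h1 x h, hf.1 x hx]
    · exact h2 x h
  · rcases le_or_gt p q with hpq | hpq
    · have hc : Continuous fun x => f (max p (min x q)) + x - max p (min x q) := by
        have := hf.2.1
        fun_prop
      refine hc.congr fun x => ?_
      by_cases h : x ∈ Ico p q
      · rw [h1 x h, min_eq_left h.2.le, max_eq_right h.1]; ring
      · rw [h2 x h]
        rcases lt_or_ge x p with hx | hx
        · rw [max_eq_left ((min_le_left _ _).trans hx.le), hfp]; ring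
        · have hx' : q ≤ x := not_lt.1 fun hxq => h ⟨hx, hxq⟩
          rw [min_eq_right hx', max_eq_right hpq, hfq]; ring
    · exact continuous_id.congr fun x => (h2 x (by simp [Ico_eq_empty hpq.not_gt])).symm
  · intro x hx
    simp only [Finset.coe_union, Finset.coe_insert, Finset.coe_singleton, mem_union,
      mem_insert_iff, mem_singleton_iff] at hx
    rcases hx with h | rfl | rfl
    exacts [hBA h, hp, hq]
  · intro x hx
    simp only [Finset.mem_union, Finset.mem_insert, Finset.mem_singleton] at hx
    have hx' : x ∈ A ∧ f x ∈ A := by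
      rcases hx with h | rfl | rfl
      exacts [⟨(hBA h).1, hBf x h⟩, ⟨hp.1, hfp.symm ▸ hp.1⟩, ⟨hq.1, hfq.symm ▸ hq.1⟩]
    by_cases h : x ∈ Ico p q
    · rw [h1 x h]; exact hx'.2
    · rw [h2 x h]; exact hx'.1
  · intro x hx
    simp only [Finset.coe_union, Finset.coe_insert, Finset.coe_singleton, mem_union,
      mem_insert_iff, mem_singleton_iff, not_or] at hx
    obtain ⟨hxB, hxp, hxq⟩ := hx
    change LocAff L g x
    rcases lt_or_gt_of_ne hxp with h | h
    · refine (locAff_id hL x).congr ?_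
      filter_upwards [Iio_mem_nhds h] with t ht using h2 t fun h' => not_lt.2 h'.1 ht
    rcases lt_or_gt_of_ne hxq with h' | h'
    · refine LocAff.congr (hB x hxB) ?_
      filter_upwards [Ioo_mem_nhds h h'] with t ht using h1 t (Ioo_subset_Ico_self ht)
    · refine (locAff_id hL x).congr ?_
      filter_upwards [Ioi_mem_nhds h'] with t ht using h2 t fun h' => lt_asymm h'.2 ht

theorem memF.exists_locAff_right (hf : memF r L A f) (p : ℝ) :
    ∃ q > p, ∀ x ∈ Ioo p q, LocAff L f x := by
  obtain ⟨B, -, -, hB⟩ := hf.2.2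
  have h : ((B : Set ℝ) \ {p})ᶜ ∈ nhds p :=
    (B.finite_toSet.subset sdiff_subset).isClosed.isOpen_compl.mem_nhds (by simp)
  obtain ⟨ε, hε, h⟩ := Metric.mem_nhds_iff.1 h
  rw [Real.ball_eq_Ioo] at h
  exact ⟨p + ε, by linarith, fun x hx => hB x fun hxB =>
    h (show x ∈ Ioo (p - ε) (p + ε) from ⟨by linarith [hx.1], hx.2⟩) ⟨hxB, hx.1.ne'⟩⟩

theorem memF.exists_locAff_left (hf : memF r L A f) (q : ℝ) :
    ∃ p < q, ∀ x ∈ Ioo p q, LocAff L f x := by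
  obtain ⟨B, -, -, hB⟩ := hf.2.2
  have h : ((B : Set ℝ) \ {q})ᶜ ∈ nhds q :=
    (B.finite_toSet.subset sdiff_subset).isClosed.isOpen_compl.mem_nhds (by simp)
  obtain ⟨ε, hε, h⟩ := Metric.mem_nhds_iff.1 h
  rw [Real.ball_eq_Ioo] at h
  exact ⟨q - ε, by linarith, fun x hx => hB x fun hxB =>
    h (show x ∈ Ioo (q - ε) (q + ε) from ⟨hx.1, by linarith [hx.2]⟩) ⟨hxB, hx.2.ne⟩⟩

theorem inv_mem_Ioo_iff (hf : StrictMono f) {p q x : ℝ} :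
    f⁻¹ x ∈ Ioo p q ↔ x ∈ Ioo (f p) (f q) := by
  obtain ⟨t, rfl⟩ := f.surjective x
  simp [hf.lt_iff_lt]

theorem psupp_conj (f g : Equiv.Perm ℝ) : psupp (f * g * f⁻¹) = {x | f⁻¹ x ∈ psupp g} := by
  ext x
  simp only [psupp, mem_ofPred_eq, Equiv.Perm.mul_apply, ne_eq, Equiv.Perm.eq_inv_iff_eq]

theorem Commute.mem_psupp_iff (h : Commute f g) (x : ℝ) : g x ∈ psupp f ↔ x ∈ psupp f := by
  have := Equiv.congr_fun h.eq x
  simp only [Equiv.Perm.mul_apply] at this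
  simp [psupp, this]

theorem map_endpoints (hg : StrictMono g) {p q : ℝ} (hpq : p < q)
    (h : ∀ x, g x ∈ Ioo p q ↔ x ∈ Ioo p q) : g p = p ∧ g q = q := by
  have himg : g '' Ioo p q = Ioo (g p) (g q) :=
    (hg.orderIsoOfSurjective g g.surjective).image_Ioo p q
  have himg' : g '' Ioo p q = Ioo p q := by
    ext x
    obtain ⟨t, rfl⟩ := g.surjective x
    rw [g.injective.mem_set_image, h]
  rw [himg] at himg'
  refine ⟨?_, ?_⟩
  · rw [← csInf_Ioo (hg hpq), himg', csInf_Ioo hpq]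
  · rw [← csSup_Ioo (hg hpq), himg', csSup_Ioo hpq]

end MemF

/-- A bi-infinite orbit of a strictly monotone permutation, inside an interval all of whose points
it moves to the right, gets arbitrarily close to both ends of the interval. -/
theorem exists_orbit_near_ends {a : Equiv.Perm ℝ} (ha : StrictMono a) {p r : ℝ}
    (hlt : ∀ x ∈ Ioo p r, x < a x) {s : ℤ → ℝ} (hs : ∀ k, s k ∈ Ioo p r)
    (hrec : ∀ k, s (k + 1) = a (s k)) :
    (∀ c > p, ∃ k, s k < c) ∧ ∀ c < r, ∃ k, c < s k := by
  constructor
  · intro c hc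
    by_contra! h
    have hbd : BddBelow (range s) := ⟨c, by rintro _ ⟨k, rfl⟩; exact h k⟩
    have h1 : c ≤ sInf (range s) := le_csInf (range_nonempty s) (by rintro _ ⟨k, rfl⟩; exact h k)
    have h2 := hlt (sInf (range s))
      ⟨hc.trans_le h1, (csInf_le hbd ⟨0, rfl⟩).trans_lt (hs 0).2⟩
    refine absurd h2 (not_lt.2 (le_csInf (range_nonempty s) ?_))
    rintro _ ⟨k, rfl⟩
    rw [← sub_add_cancel k 1, hrec]
    exact ha.monotone (csInf_le hbd ⟨_, rfl⟩)
  · intro c hc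
    by_contra! h
    have hbd : BddAbove (range s) := ⟨c, by rintro _ ⟨k, rfl⟩; exact h k⟩
    have h1 : sSup (range s) ≤ c := csSup_le (range_nonempty s) (by rintro _ ⟨k, rfl⟩; exact h k)
    have h2 := hlt (sSup (range s))
      ⟨(hs 0).1.trans_le (le_csSup hbd ⟨0, rfl⟩), h1.trans_lt hc⟩
    have h3 : sSup (range s) ≤ a.symm (sSup (range s)) := by
      refine csSup_le (range_nonempty s) ?_
      rintro _ ⟨k, rfl⟩
      rw [← ha.le_iff_le, Equiv.apply_symm_apply, ← hrec]
      exact le_csSup hbd ⟨_, rfl⟩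
    have h4 := ha.monotone h3
    rw [Equiv.apply_symm_apply] at h4
    exact absurd h2 (not_lt.2 h4)

/-- With `a`, `b`, `αₖ`, `bₖ = a⁻ᵏ b aᵏ` as in the previous
statement, let `d` be a generator of the centralizer of `b` in `F_{(α₀,α₁)}`.
Then the centralizer in `F` of `{bₖ : k ∈ ℤ}` equals the subgroup generated by
`{a⁻ᵏ d aᵏ : k ∈ ℤ}`.  (With the paper's right-action convention `a⁻ᵏ y aᵏ`
corresponds, for left actions, to `aᵏ ∘ y ∘ a⁻ᵏ`.) -/
theorem centralizer_bk_eq_closure_dk (r : ℝ) (L A : Set ℝ) (hr : 0 < r)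
    (hL : IsSlopeSubgroup L) (hLne : L ≠ {1}) (hA : IsSlopeModule r L A)
    (a b : Equiv.Perm ℝ)
    (ha : memF r L A a) (haup : ∀ x ∈ Ico (0:ℝ) r, x ≤ a x)
    (hsa : psupp a = Ioo 0 r)
    (α₀ : ℝ) (hα₀ : α₀ ∈ Ioo 0 r ∩ A)
    (αs : ℤ → ℝ) (hαs : ∀ k : ℤ, αs k = (a ^ k) α₀)
    (hb : memF r L A b) (hbup : ∀ x ∈ Ico (0:ℝ) r, x ≤ b x)
    (hsb : psupp b = Ioo (αs 0) (αs 1))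
    (d : Equiv.Perm ℝ)
    (hd : {y : Equiv.Perm ℝ | memFS r L A (Ioo (αs 0) (αs 1)) y ∧ Commute b y} =
      Set.range fun n : ℤ => d ^ n) :
    {y : Equiv.Perm ℝ | memF r L A y ∧ ∀ k : ℤ, Commute (a ^ k * b * a ^ (-k)) y} =
      ↑(Subgroup.closure (Set.range fun k : ℤ => a ^ k * d * a ^ (-k))) := by
  have haS := ha.strictMono_s9
  have hak : ∀ k : ℤ, memF r L A (a ^ k) := ha.zpow hr hL hA
  have hlt : ∀ x ∈ Ioo 0 r, x < a x := fun x hx =>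
    lt_of_le_of_ne (haup x (Ioo_subset_Ico_self hx)) (Ne.symm (by rw [← hsa] at hx; exact hx))
  have hα : ∀ k, αs k ∈ Ioo 0 r := fun k => by
    rw [hαs]
    refine ⟨?_, ((apply_mem_iff (hak k).1 α₀).2 (Ioo_subset_Ico_self hα₀.1)).2⟩
    rw [← (hak k).map_zero_s9 hr]
    exact (hak k).strictMono_s9 hα₀.1.1
  have hαA : ∀ k, αs k ∈ A ∩ Icc 0 r := fun k =>
    ⟨by rw [hαs]; exact (hak k).map_mem hr hA hα₀.2, Ioo_subset_Icc_self (hα k)⟩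
  have hrec : ∀ k, αs (k + 1) = a (αs k) := fun k => by
    rw [hαs, hαs, add_comm, zpow_one_add, Equiv.Perm.mul_apply]
  have hmono : StrictMono αs := strictMono_int_of_lt_succ fun k => by
    rw [hrec]; exact hlt _ (hα k)
  have hpull : ∀ (k : ℤ) (x : ℝ),
      (a ^ k)⁻¹ x ∈ Ioo (αs 0) (αs 1) ↔ x ∈ Ioo (αs k) (αs (k + 1)) := fun k x => by
    rw [inv_mem_Ioo_iff (hak k).strictMono_s9]
    have h0 : (a ^ k) (αs 0) = αs k := by simp [hαs]
    have h1 : (a ^ k) (αs 1) = αs (k + 1) := by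
      rw [hαs, hαs, zpow_add, Equiv.Perm.mul_apply]
    rw [h0, h1]
  have hbk : ∀ k : ℤ, psupp (a ^ k * b * a ^ (-k)) = Ioo (αs k) (αs (k + 1)) := fun k => by
    ext x
    rw [zpow_neg, psupp_conj, mem_ofPred_eq, hsb, hpull]
  have hdmem : memFS r L A (Ioo (αs 0) (αs 1)) d ∧ Commute b d := by
    have : d ∈ range fun n : ℤ => d ^ n := ⟨1, zpow_one d⟩
    rwa [← hd] at this
  have hdk : ∀ k : ℤ, psupp (a ^ k * d * a ^ (-k)) ⊆ Ioo (αs k) (αs (k + 1)) := fun k x hx => by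
    rw [zpow_neg, psupp_conj] at hx
    exact (hpull k x).1 (hdmem.1.2 hx)
  set C := Subgroup.closure (range fun k : ℤ => a ^ k * d * a ^ (-k)) with hC
  have hCle : ∀ y ∈ C, memF r L A y ∧ ∀ k : ℤ, Commute (a ^ k * b * a ^ (-k)) y := by
    have hle : C ≤ slopeGroup hr hL hA ⊓
        Subgroup.centralizer (range fun k : ℤ => a ^ k * b * a ^ (-k)) := by
      rw [hC, Subgroup.closure_le]
      rintro _ ⟨k, rfl⟩
      refine ⟨((hak k).mul_s9 hr hL hA hdmem.1.1).mul_s9 hr hL hA (hak (-k)), ?_⟩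
      refine Subgroup.mem_centralizer_iff.2 ?_
      rintro _ ⟨j, rfl⟩
      change Commute (a ^ j * b * a ^ (-j)) (a ^ k * d * a ^ (-k))
      rcases eq_or_ne j k with rfl | hjk
      · rw [zpow_neg]
        exact hdmem.2.conj _
      · refine Equiv.Perm.Disjoint.commute fun x => ?_
        by_contra! h
        have h1 : x ∈ Ioo (αs j) (αs (j + 1)) := by rw [← hbk]; exact h.1
        have h2 := hdk k h.2
        have h3 := hmono.lt_iff_lt.1 (h1.1.trans h2.2)
        have h4 := hmono.lt_iff_lt.1 (h2.1.trans h1.2)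
        omega
    intro y hy
    obtain ⟨h1, h2⟩ := hle hy
    exact ⟨h1, fun k => Subgroup.mem_centralizer_iff.1 h2 _ ⟨k, rfl⟩⟩
  refine Subset.antisymm ?_ hCle
  have hfix : ∀ y : Equiv.Perm ℝ, memF r L A y →
      (∀ k : ℤ, Commute (a ^ k * b * a ^ (-k)) y) → ∀ k, y (αs k) = αs k := by
    intro y hy hc k
    refine (map_endpoints hy.strictMono_s9 (hmono (lt_add_one k)) fun x => ?_).1
    rw [← hbk]
    exact (hc k).mem_psupp_iff x
  -- an element of the centralizer supported in finitely many of the intervals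
  have hfin : ∀ (m : ℤ) (n : ℕ) (y : Equiv.Perm ℝ), memF r L A y →
      (∀ k : ℤ, Commute (a ^ k * b * a ^ (-k)) y) →
      (∀ x, x ∉ Ico (αs m) (αs (m + n)) → y x = x) → y ∈ C := by
    intro m n
    induction n with
    | zero =>
      intro y _ _ h
      have : y = 1 := Equiv.ext fun x => h x (by simp)
      rw [this]; exact C.one_mem
    | succ n ih =>
      intro y hy hc h
      set k : ℤ := m + n with hk
      have hk1 : m + ((n + 1 : ℕ) : ℤ) = k + 1 := by push_cast; ring
      rw [hk1] at h
      obtain ⟨z, hz, hzy, hzid⟩ := hy.exists_restrict hL (hαA k) (hαA (k + 1))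
        (hfix y hy hc k) (hfix y hy hc (k + 1))
      have hzsupp : psupp z ⊆ Ioo (αs k) (αs (k + 1)) := fun x hx => by
        have hx' : x ∈ Ico (αs k) (αs (k + 1)) := by_contra fun h' => hx (hzid x h')
        refine ⟨lt_of_le_of_ne hx'.1 fun h' => hx ?_, hx'.2⟩
        rw [hzy x hx', ← h', hfix y hy hc k]
      have hzc : Commute (a ^ k * b * a ^ (-k)) z := by
        set c := a ^ k * b * a ^ (-k) with hcdef
        have hcid : ∀ x, x ∉ Ico (αs k) (αs (k + 1)) → c x = x := fun x hx => by
          by_contra h'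
          have h'' : x ∈ psupp c := h'
          rw [hbk k] at h''
          exact hx (Ioo_subset_Ico_self h'')
        refine Equiv.ext fun x => ?_
        change c (z x) = z (c x)
        by_cases hx : x ∈ Ico (αs k) (αs (k + 1))
        · rw [hzy x hx, hzy _ ((apply_mem_iff hcid x).2 hx)]
          exact Equiv.congr_fun (hc k).eq x
        · rw [hzid x hx, hcid x hx, hzid x hx]
      have hzC : z ∈ C := by
        have hw : a ^ (-k) * z * a ^ k ∈ range fun n : ℤ => d ^ n := by
          rw [← hd]
          refine ⟨⟨((hak (-k)).mul_s9 hr hL hA hz).mul_s9 hr hL hA (hak k), fun x hx => ?_⟩, ?_⟩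
          · have h1 : (a ^ k) x ∈ psupp z := fun h' => hx (by
              simp [Equiv.Perm.mul_apply, h', zpow_neg])
            have := (hpull k _).2 (hzsupp h1)
            simpa using this
          · have := hzc.conj (a ^ (-k))
            simpa [zpow_neg, mul_assoc] using this
        obtain ⟨j, hj⟩ := hw
        have hzj : z = (a ^ k * d * a ^ (-k)) ^ j := by
          simp only at hj
          rw [zpow_neg, conj_zpow, hj, zpow_neg]
          group
        rw [hzj]
        exact C.zpow_mem (Subgroup.subset_closure ⟨k, rfl⟩) j
      have hzi := hCle _ (C.inv_mem hzC)
      have hyz : y * z⁻¹ ∈ C := by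
        refine ih _ (hy.mul_s9 hr hL hA hzi.1) (fun j => (hc j).mul_right (hzi.2 j)) fun x hx => ?_
        obtain ⟨t, rfl⟩ := z.surjective x
        rw [← Equiv.Perm.mul_apply, inv_mul_cancel_right]
        by_cases ht : t ∈ Ico (αs k) (αs (k + 1))
        · exact (hzy t ht).symm
        · rw [hzid t ht] at hx ⊢
          refine h t fun h' => ?_
          rcases lt_or_ge t (αs k) with h'' | h''
          exacts [hx ⟨h'.1, h''⟩, ht ⟨h'', h'.2⟩]
      simpa using C.mul_mem hyz hzC
  rintro y ⟨hy, hc⟩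
  have hf := hfix y hy hc
  obtain ⟨hnear0, hnearr⟩ := exists_orbit_near_ends haS hlt hα hrec
  obtain ⟨q, hq, hyq⟩ := hy.exists_locAff_right 0
  obtain ⟨p, hp, hyp⟩ := hy.exists_locAff_left r
  obtain ⟨m, hm⟩ := hnear0 q hq
  obtain ⟨n, hn⟩ := hnearr p hp
  have hlow : ∀ x < αs m, y x = x := fun x hx => by
    rcases le_or_gt x 0 with h0 | h0
    · rcases h0.eq_or_lt with rfl | h0
      · exact hy.map_zero_s9 hr
      · exact hy.1 x fun h => not_lt.2 h.1 h0
    · have h1 := hmono (sub_one_lt m)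
      exact eq_self_of_locAff hyq ⟨(hα _).1, h1.trans hm⟩ ⟨(hα m).1, hm⟩ h1 (hf _) (hf _)
        ⟨h0, hx.trans hm⟩
  have hhigh : ∀ x ≥ αs n, y x = x := fun x hx => by
    rcases le_or_gt r x with h0 | h0
    · exact hy.1 x fun h => not_lt.2 h0 h.2
    · have h1 := hmono (lt_add_one n)
      exact eq_self_of_locAff hyp ⟨hn, (hα n).2⟩ ⟨hn.trans h1, (hα _).2⟩ h1 (hf _) (hf _)
        ⟨hn.trans_le hx, h0⟩
  refine hfin m (n - m).toNat y hy hc fun x hx => ?_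
  rcases lt_or_ge x (αs m) with h | h
  · exact hlow x h
  · refine hhigh x (le_of_not_gt fun h' => hx ⟨h, h'.trans_le (hmono.monotone ?_)⟩)
    omega
end
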